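/- arXiv:2312.15361 — 4 statements merged into one kernel-verified Lean document; each statement's English description precedes it below -/
import Mathlib

section
/- Consider federated learning over J clusters with the following setup. For each cluster j = 1,…,J there is a finite set G_j of clients; after data offloading, each client k ∈ G_j holds a finite dataset D̂_k^c of n_k^c ≥ 2 points in a real inner product space X, and the satellite of cluster j holds a finite dataset D̂_j^s of n_j^s ≥ 2 points in X. Let s_j = n_j^s + Σ_{k∈G_j} n_k^c. The loss ℓ(x; w) is a real-valued function of a data point x ∈ X and a model w in a real Hilbert space W, differentiable in w. Define the client loss ℓ_{C,k}(w) as the average of ℓ(x; w) over D̂_k^c, the satellite loss ℓ_{S,j}(w) as the average of ℓ(x; w) over D̂_j^s, the cluster objective F_j(w) = (n_j^s ℓ_{S,j}(w) + Σ_{k∈G_j} n_k^c ℓ_{C,k}(w)) / s_j, and the global objective F(w) = (1/J) Σ_{j=1}^J F_j(w). Assume: (i) every ℓ_{C,k} and ℓ_{S,j} has an L-Lipschitz gradient in w; (ii) squared data variability: ‖∇_w ℓ(x; w) − ∇_w ℓ(x′; w)‖² ≤ ρ‖x − x′‖² for all w and all x, x′ belonging to a common dataset D̂_k^c or D̂_j^s;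 (iii) F(w) ≥ F* for all w. The algorithm runs rounds r = 0,…,R−1 with step sizes 0 < η_r ≤ 1/(2L): at round r each client k draws a uniformly random mini-batch of size λ_{C,k}^r (with 1 ≤ λ_{C,k}^r ≤ n_k^c) without replacement from D̂_k^c, and each satellite j draws a uniformly random mini-batch of size λ_{S,j}^r (with 1 ≤ λ_{S,j}^r ≤ n_j^s) without replacement from D̂_j^s, all draws independent across nodes and rounds; the stochastic gradient is ∇̃F(w^r) = (1/J) Σ_j (1/s_j)(n_j^s ∇̃ℓ_{S,j}(w^r) + Σ_{k∈G_j} n_k^c ∇̃ℓ_{C,k}(w^r)), where ∇̃ℓ denotes the average of ∇_w ℓ(x; w^r) over the corresponding mini-batch, and the update is w^{r+1} = w^r − η_r ∇̃F(w^r). Let Γ_R = Σ_{r=0}^{R−1} η_r, and let V_{C,k} and V_{S,j} denote the sample variances (1/(n−1)) Σ_x ‖x − x̄‖² of the datasets D̂_k^c and D̂_j^s respectively, where x̄ is the dataset's mean. Define Ω = 2 Σ_{r=0}^{R−1} (1/J) Σ_{j=1}^J (1/s_j) [ Σ_{k∈G_j} (1 − λ_{C,k}^r/n_k^c) ((n_k^c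 − 1)ρ/λ_{C,k}^r) V_{C,k} + (1 − λ_{S,j}^r/n_j^s) ((n_j^s − 1)ρ/λ_{S,j}^r) V_{S,j} ]. Then, with E denoting expectation over all mini-batch draws, (1/Γ_R) Σ_{r=0}^{R−1} η_r E[‖∇F(w^r)‖²] ≤ 2(F(w^0) − F*)/Γ_R + (2LΩ/Γ_R) Σ_{r=0}^{R−1} η_r². -/
open scoped Classical

/-- Sample space of the randomized algorithm: for each round `r < R`, a choice, for each
cluster `j`, of a mini-batch (subset) of the satellite dataset of cluster `j`, and, for
each client `k` of cluster `j`, of a mini-batch of that client's dataset. -/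
abbrev FLSampleSpace (R J : ℕ) (K : Fin J → ℕ) (ns : Fin J → ℕ)
    (nc : (j : Fin J) → Fin (K j) → ℕ) : Type :=
  (Fin R) → ((j : Fin J) → Finset (Fin (ns j))) ×
    ((j : Fin J) → (k : Fin (K j)) → Finset (Fin (nc j k)))

section

variable {ι W : Type*} [Fintype ι] [NormedAddCommGroup W] [InnerProductSpace ℝ W]

theorem sum_sub_mean_eq_zero [Nonempty ι] (g : ι → W) :
    ∑ i, (g i - (Fintype.card ι : ℝ)⁻¹ • ∑ i', g i') = 0 := by
  have : (Fintype.card ι : ℝ) ≠ 0 := by exact_mod_cast Fintype.card_ne_zero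
  rw [Finset.sum_sub_distrib, Finset.sum_const, Finset.card_univ,
    ← Nat.cast_smul_eq_nsmul ℝ, smul_smul, mul_inv_cancel₀ this, one_smul, sub_self]

theorem sum_norm_sq_sub_eq [Nonempty ι] (g : ι → W) :
    ∑ i, ∑ i', ‖g i - g i'‖ ^ 2 =
      2 * Fintype.card ι * ∑ i, ‖g i - (Fintype.card ι : ℝ)⁻¹ • ∑ i', g i'‖ ^ 2 := by
  set m := (Fintype.card ι : ℝ)⁻¹ • ∑ i', g i'
  have h0 : ∑ i, (g i - m) = 0 := sum_sub_mean_eq_zero g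
  have hpt (i i' : ι) : ‖g i - g i'‖ ^ 2 =
      ‖g i - m‖ ^ 2 - 2 * inner ℝ (g i - m) (g i' - m) + ‖g i' - m‖ ^ 2 := by
    rw [← norm_sub_sq_real, sub_sub_sub_cancel_right]
  simp only [hpt, Finset.sum_add_distrib, Finset.sum_sub_distrib, ← Finset.mul_sum, ← inner_sum]
  simp only [← Finset.sum_sub_distrib]
  rw [h0]
  simp only [inner_zero_right, Finset.sum_const, Finset.card_univ, nsmul_eq_mul, mul_zero,
    sub_zero, ← Finset.mul_sum]
  ring

theorem sum_norm_sq_sub_mean_le {X : Type*} [NormedAddCommGroup X] [InnerProductSpace ℝ X]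
    [Nonempty ι] {g : ι → W} {x : ι → X} {ρ : ℝ}
    (h : ∀ i i', ‖g i - g i'‖ ^ 2 ≤ ρ * ‖x i - x i'‖ ^ 2) :
    ∑ i, ‖g i - (Fintype.card ι : ℝ)⁻¹ • ∑ i', g i'‖ ^ 2 ≤
      ρ * ∑ i, ‖x i - (Fintype.card ι : ℝ)⁻¹ • ∑ i', x i'‖ ^ 2 := by
  have hpos : (0 : ℝ) < 2 * Fintype.card ι := by
    have : 0 < Fintype.card ι := Fintype.card_pos
    positivity
  refine le_of_mul_le_mul_left ?_ hpos
  rw [mul_left_comm, ← sum_norm_sq_sub_eq, ← sum_norm_sq_sub_eq, Finset.mul_sum]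
  refine Finset.sum_le_sum fun i _ => ?_
  rw [Finset.mul_sum]
  exact Finset.sum_le_sum fun i' _ => h i i'

theorem batch_mean_sub_mean [Nonempty ι] (g : ι → W) {S : Finset ι} (hS : S.card ≠ 0) :
    (S.card : ℝ)⁻¹ • ∑ i ∈ S, g i - (Fintype.card ι : ℝ)⁻¹ • ∑ i, g i =
      (S.card : ℝ)⁻¹ • ∑ i ∈ S, (g i - (Fintype.card ι : ℝ)⁻¹ • ∑ i', g i') := by
  have : (S.card : ℝ) ≠ 0 := by exact_mod_cast hS
  rw [Finset.sum_sub_distrib, Finset.sum_const, ← Nat.cast_smul_eq_nsmul ℝ, smul_sub,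
    smul_smul, inv_mul_cancel₀ this, one_smul]

end

section

variable {ι W : Type*} [Fintype ι] [DecidableEq ι]

theorem sum_perm_apply_eq_zero [AddCommGroup W] [Module ℝ W] (a : ι → W)
    (ha : ∑ i, a i = 0) (i : ι) : ∑ σ : Equiv.Perm ι, a (σ i) = 0 := by
  have hconst (j : ι) : ∑ σ : Equiv.Perm ι, a (σ j) = ∑ σ : Equiv.Perm ι, a (σ i) := by
    rw [← Equiv.sum_comp (Equiv.mulRight (Equiv.swap i j)) (fun σ => a (σ j))]
    simp
  have hsum : ∑ j, ∑ σ : Equiv.Perm ι, a (σ j) = 0 := by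
    rw [Finset.sum_comm]
    refine Finset.sum_eq_zero fun σ _ => ?_
    rw [Equiv.sum_comp σ a, ha]
  rw [Finset.sum_congr rfl fun j _ => hconst j, Finset.sum_const, Finset.card_univ,
    ← Nat.cast_smul_eq_nsmul ℝ] at hsum
  have : Nonempty ι := ⟨i⟩
  exact (smul_eq_zero.mp hsum).resolve_left (by exact_mod_cast Fintype.card_ne_zero)

theorem factorial_mul_sum_eq_sum_perm {Z Ω : Type*} {V : Finset Ω} {u : Ω → Z}
    {B : Ω → Finset ι}
    (hexch : ∀ (σ : Equiv.Perm ι) (f : Z → Finset ι → ℝ),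
      ∑ ω ∈ V, f (u ω) ((B ω).map σ.toEmbedding) = ∑ ω ∈ V, f (u ω) (B ω))
    (f : Z → Finset ι → ℝ) :
    (Fintype.card ι).factorial * ∑ ω ∈ V, f (u ω) (B ω) =
      ∑ ω ∈ V, ∑ σ : Equiv.Perm ι, f (u ω) ((B ω).map σ.toEmbedding) := by
  rw [Finset.sum_comm, Finset.sum_congr rfl fun σ _ => hexch σ f, Finset.sum_const,
    Finset.card_univ, Fintype.card_perm, nsmul_eq_mul]

variable [NormedAddCommGroup W] [InnerProductSpace ℝ W]

/-- Variance of sampling without replacement, as an average over all permutations. -/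
theorem sum_perm_norm_sq_sum (hn : 2 ≤ Fintype.card ι) (a : ι → W) (ha : ∑ i, a i = 0)
    (S : Finset ι) :
    ∑ σ : Equiv.Perm ι, ‖∑ i ∈ S.map σ.toEmbedding, a i‖ ^ 2 =
      (Fintype.card ι).factorial *
        ((S.card : ℝ) * (Fintype.card ι - S.card) /
          (Fintype.card ι * ((Fintype.card ι : ℝ) - 1)) * ∑ i, ‖a i‖ ^ 2) := by
  set n := Fintype.card ι
  have hn' : (2 : ℝ) ≤ n := by exact_mod_cast hn
  set c : ι → ι → ℝ := fun i i' => ∑ σ : Equiv.Perm ι, inner ℝ (a (σ i)) (a (σ i')) with hc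
  have hinv (τ : Equiv.Perm ι) (i i' : ι) : c (τ i) (τ i') = c i i' := by
    simp only [hc]
    rw [← Equiv.sum_comp (Equiv.mulRight τ)
      (fun σ : Equiv.Perm ι => (inner ℝ (a (σ i)) (a (σ i')) : ℝ))]
    simp
  have hrow (i : ι) : ∑ i', c i i' = 0 := by
    simp only [hc]
    rw [Finset.sum_comm]
    refine Finset.sum_eq_zero fun σ _ => ?_
    rw [← inner_sum, Equiv.sum_comp σ a, ha, inner_zero_right]
  set p : ℝ := (n.factorial : ℝ) / n * ∑ i, ‖a i‖ ^ 2 with hp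
  have hdiag (i : ι) : c i i = p := by
    have hconst (j : ι) : c j j = c i i := by
      have := hinv (Equiv.swap i j) i i
      simpa using this
    have hsum : ∑ j, c j j = n.factorial * ∑ i, ‖a i‖ ^ 2 := by
      simp only [hc]
      rw [Finset.sum_comm]
      simp only [real_inner_self_eq_norm_sq]
      rw [Finset.sum_congr rfl fun σ _ => Equiv.sum_comp σ fun i => ‖a i‖ ^ 2,
        Finset.sum_const, Finset.card_univ, Fintype.card_perm, nsmul_eq_mul]
    rw [Finset.sum_congr rfl fun j _ => hconst j, Finset.sum_const, Finset.card_univ,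
      nsmul_eq_mul] at hsum
    rw [hp]
    field_simp
    linarith
  have hoff (i i' : ι) (h : i ≠ i') : c i i' = -p / (n - 1) := by
    have hconst (j : ι) (hj : j ≠ i) : c i j = c i i' := by
      have := hinv (Equiv.swap i' j) i i'
      rw [Equiv.swap_apply_left, Equiv.swap_apply_of_ne_of_ne h hj.symm] at this
      exact this
    have hsum := hrow i
    rw [← Finset.add_sum_erase _ _ (Finset.mem_univ i), hdiag i,
      Finset.sum_congr rfl fun j hj => hconst j (Finset.ne_of_mem_erase hj),
      Finset.sum_const, Finset.card_erase_of_mem (Finset.mem_univ i), Finset.card_univ,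
      nsmul_eq_mul, Nat.cast_sub (by omega), Nat.cast_one] at hsum
    rw [eq_div_iff (by linarith)]
    linarith
  have hexpand : ∑ σ : Equiv.Perm ι, ‖∑ i ∈ S.map σ.toEmbedding, a i‖ ^ 2 =
      ∑ i ∈ S, ∑ i' ∈ S, c i i' := by
    simp only [hc, Finset.sum_map, ← real_inner_self_eq_norm_sq, sum_inner, inner_sum]
    rw [Finset.sum_comm]
    refine Finset.sum_congr rfl fun i _ => ?_
    rw [Finset.sum_comm]
    refine Finset.sum_congr rfl fun i' _ => Finset.sum_congr rfl fun σ _ => ?_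
    exact real_inner_comm _ _
  have hrowS (i : ι) (hi : i ∈ S) :
      ∑ i' ∈ S, c i i' = p + (S.card - 1) * (-p / (n - 1)) := by
    rw [← Finset.add_sum_erase _ _ hi, hdiag i,
      Finset.sum_congr rfl fun j hj => hoff i j (Finset.ne_of_mem_erase hj).symm,
      Finset.sum_const, Finset.card_erase_of_mem hi, nsmul_eq_mul,
      Nat.cast_sub (Finset.card_pos.mpr ⟨i, hi⟩), Nat.cast_one]
  rw [hexpand, Finset.sum_congr rfl hrowS, Finset.sum_const, nsmul_eq_mul, hp]
  have h1 : (n : ℝ) - 1 ≠ 0 := by linarith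
  field_simp
  ring

variable {Ω : Type*} {V : Finset Ω} {u : Ω → W} {B : Ω → Finset ι}

/-- The mini-batch gradient of an exchangeable mini-batch is unbiased. -/
theorem sum_inner_batch_mean_sub_mean [Nonempty ι] {l : ℕ}
    (hexch : ∀ (σ : Equiv.Perm ι) (f : W → Finset ι → ℝ),
      ∑ ω ∈ V, f (u ω) ((B ω).map σ.toEmbedding) = ∑ ω ∈ V, f (u ω) (B ω))
    (hl : 1 ≤ l) (hB : ∀ ω ∈ V, (B ω).card = l) (g : ι → W → W) (v : W → W) :
    ∑ ω ∈ V, inner ℝ (v (u ω)) ((l : ℝ)⁻¹ • ∑ i ∈ B ω, g i (u ω) -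
      (Fintype.card ι : ℝ)⁻¹ • ∑ i, g i (u ω)) = 0 := by
  set a : W → ι → W := fun z i => g i z - (Fintype.card ι : ℝ)⁻¹ • ∑ i', g i' z
  have hsum : ∑ ω ∈ V, inner ℝ (v (u ω)) (∑ i ∈ B ω, a (u ω) i) = 0 := by
    have h := factorial_mul_sum_eq_sum_perm hexch
      fun z S => inner ℝ (v z) (∑ i ∈ S, a z i)
    have hzero (ω : Ω) : ∑ σ : Equiv.Perm ι,
        inner ℝ (v (u ω)) (∑ i ∈ (B ω).map σ.toEmbedding, a (u ω) i) = 0 := by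
      simp only [Finset.sum_map]
      rw [← inner_sum, Finset.sum_comm]
      rw [Finset.sum_eq_zero fun i _ => ?_, inner_zero_right]
      exact sum_perm_apply_eq_zero (a (u ω)) (sum_sub_mean_eq_zero fun i => g i (u ω)) i
    rw [Finset.sum_eq_zero fun ω _ => hzero ω] at h
    exact (mul_eq_zero.mp h).resolve_left (by exact_mod_cast Nat.factorial_ne_zero _)
  have hcongr : ∀ ω ∈ V, inner ℝ (v (u ω)) ((l : ℝ)⁻¹ • ∑ i ∈ B ω, g i (u ω) -
      (Fintype.card ι : ℝ)⁻¹ • ∑ i, g i (u ω)) =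
      (l : ℝ)⁻¹ * inner ℝ (v (u ω)) (∑ i ∈ B ω, a (u ω) i) := fun ω hω => by
    have hc := hB ω hω
    rw [← real_inner_smul_right, ← hc, batch_mean_sub_mean _ (by omega)]
  rw [Finset.sum_congr rfl hcongr, ← Finset.mul_sum, hsum, mul_zero]

/-- Variance bound for the mini-batch gradient of an exchangeable mini-batch. -/
theorem sum_norm_sq_batch_mean_sub_mean_le {X : Type*} [NormedAddCommGroup X]
    [InnerProductSpace ℝ X] {l : ℕ} (hn : 2 ≤ Fintype.card ι)
    (hexch : ∀ (σ : Equiv.Perm ι) (f : W → Finset ι → ℝ),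
      ∑ ω ∈ V, f (u ω) ((B ω).map σ.toEmbedding) = ∑ ω ∈ V, f (u ω) (B ω))
    (hl : 1 ≤ l) (hln : l ≤ Fintype.card ι) (hB : ∀ ω ∈ V, (B ω).card = l)
    {g : ι → W → W} {x : ι → X} {ρ : ℝ}
    (h : ∀ z i i', ‖g i z - g i' z‖ ^ 2 ≤ ρ * ‖x i - x i'‖ ^ 2) :
    ∑ ω ∈ V, ‖(l : ℝ)⁻¹ • ∑ i ∈ B ω, g i (u ω) -
        (Fintype.card ι : ℝ)⁻¹ • ∑ i, g i (u ω)‖ ^ 2 ≤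
      V.card * ((1 - (l : ℝ) / Fintype.card ι) * (ρ / l) *
        ((∑ i, ‖x i - (Fintype.card ι : ℝ)⁻¹ • ∑ i', x i'‖ ^ 2) /
          ((Fintype.card ι : ℝ) - 1))) := by
  have : Nonempty ι := Fintype.card_pos_iff.mp (by omega)
  set n := Fintype.card ι
  have hn' : (2 : ℝ) ≤ n := by exact_mod_cast hn
  have hn1 : (0 : ℝ) < (n : ℝ) - 1 := by linarith
  have hl' : (0 : ℝ) < l := by exact_mod_cast hl
  have hln' : (0 : ℝ) ≤ n - l := by
    have : (l : ℝ) ≤ n := by exact_mod_cast hln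
    linarith
  set a : W → ι → W := fun z i => g i z - (n : ℝ)⁻¹ • ∑ i', g i' z
  have ha0 (z : W) : ∑ i, a z i = 0 := sum_sub_mean_eq_zero fun i => g i z
  have hvar : ∑ ω ∈ V, ‖∑ i ∈ B ω, a (u ω) i‖ ^ 2 =
      ∑ ω ∈ V, (l : ℝ) * (n - l) / (n * ((n : ℝ) - 1)) * ∑ i, ‖a (u ω) i‖ ^ 2 := by
    have hperm := factorial_mul_sum_eq_sum_perm hexch fun z S => ‖∑ i ∈ S, a z i‖ ^ 2
    rw [Finset.sum_congr rfl fun ω hω =>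
      (sum_perm_norm_sq_sum hn (a (u ω)) (ha0 (u ω)) (B ω)).trans
        (by rw [hB ω hω]), ← Finset.mul_sum] at hperm
    exact mul_left_cancel₀ (by exact_mod_cast Nat.factorial_ne_zero _) hperm
  have hcongr : ∀ ω ∈ V, ‖(l : ℝ)⁻¹ • ∑ i ∈ B ω, g i (u ω) -
      (n : ℝ)⁻¹ • ∑ i, g i (u ω)‖ ^ 2 =
      ((l : ℝ)⁻¹) ^ 2 * ‖∑ i ∈ B ω, a (u ω) i‖ ^ 2 := fun ω hω => by
    have hc := hB ω hω
    rw [← hc, batch_mean_sub_mean _ (by omega), norm_smul, mul_pow, Real.norm_eq_abs, sq_abs]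
  rw [Finset.sum_congr rfl hcongr, ← Finset.mul_sum, hvar, Finset.mul_sum, ← nsmul_eq_mul V.card]
  refine Finset.sum_le_card_nsmul _ _ _ fun ω _ => ?_
  calc ((l : ℝ)⁻¹) ^ 2 * ((l : ℝ) * (n - l) / (n * ((n : ℝ) - 1)) * ∑ i, ‖a (u ω) i‖ ^ 2)
      ≤ ((l : ℝ)⁻¹) ^ 2 * ((l : ℝ) * (n - l) / (n * ((n : ℝ) - 1)) *
          (ρ * ∑ i, ‖x i - (n : ℝ)⁻¹ • ∑ i', x i'‖ ^ 2)) := by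
        gcongr
        exact sum_norm_sq_sub_mean_le fun i i' => h (u ω) i i'
    _ = _ := by
        have : (n : ℝ) ≠ 0 := by linarith
        field_simp

end

section

variable {W : Type*} [NormedAddCommGroup W] [InnerProductSpace ℝ W]

theorem le_add_inner_add_of_lipschitz_gradient [CompleteSpace W] {F : W → ℝ} {G : W → W} {L : ℝ}
    (hL : 0 ≤ L) (hF : ∀ u, HasGradientAt F (G u) u) (hG : ∀ u v, ‖G u - G v‖ ≤ L * ‖u - v‖)
    (u v : W) : F v ≤ F u + inner ℝ (G u) (v - u) + L * ‖v - u‖ ^ 2 := by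
  have hbound : ∀ z ∈ Metric.closedBall u ‖v - u‖,
      ‖InnerProductSpace.toDual ℝ W (G z) - InnerProductSpace.toDual ℝ W (G u)‖ ≤
        L * ‖v - u‖ := fun z hz => by
    rw [← map_sub, LinearIsometryEquiv.norm_map]
    refine (hG z u).trans (mul_le_mul_of_nonneg_left ?_ hL)
    rwa [← dist_eq_norm]
  have hmvt := (convex_closedBall u ‖v - u‖).norm_image_sub_le_of_norm_hasFDerivWithin_le'
    (fun z _ => (hF z).hasFDerivAt.hasFDerivWithinAt) hbound
    (Metric.mem_closedBall_self (norm_nonneg _))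
    (show v ∈ Metric.closedBall u ‖v - u‖ by rw [Metric.mem_closedBall, dist_eq_norm])
  rw [InnerProductSpace.toDual_apply_apply] at hmvt
  have := (le_abs_self _).trans hmvt
  linarith [mul_assoc L ‖v - u‖ ‖v - u‖, pow_two ‖v - u‖]

theorem norm_sq_sum_smul_le {ι : Type*} [Fintype ι] {p : ι → ℝ} (hp : ∀ i, 0 ≤ p i)
    (hp1 : ∑ i, p i = 1) (d : ι → W) : ‖∑ i, p i • d i‖ ^ 2 ≤ ∑ i, p i * ‖d i‖ ^ 2 :=
  ((convexOn_norm convex_univ).pow (fun _ _ => norm_nonneg _) 2).map_sum_le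
    (fun i _ => hp i) hp1 fun _ _ => Set.mem_univ _

/-- Convergence of stochastic gradient descent over a finite sample space, for gradient noise
`d` that is unbiased and has second moment at most `σ`. -/
theorem sgd_sum_norm_sq_gradient_le [CompleteSpace W] {Ω : Type*} {V : Finset Ω} {F : W → ℝ}
    {G : W → W} {L Fstar σ : ℝ} (hL : 0 < L) (hF : ∀ u, HasGradientAt F (G u) u)
    (hG : ∀ u v, ‖G u - G v‖ ≤ L * ‖u - v‖) (hFstar : ∀ u, Fstar ≤ F u) {R : ℕ} {η : ℕ → ℝ}
    (hη : ∀ r, 0 < η r ∧ η r ≤ 1 / (2 * L)) {w0 : W} {w d : ℕ → Ω → W} (hw0 : ∀ ω, w 0 ω = w0)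
    (hw : ∀ r < R, ∀ ω, w (r + 1) ω = w r ω - η r • (G (w r ω) + d r ω))
    (hd : ∀ r < R, ∑ ω ∈ V, inner ℝ (G (w r ω)) (d r ω) = 0)
    (hσ : ∀ r < R, ∑ ω ∈ V, ‖d r ω‖ ^ 2 ≤ V.card * σ) :
    ∑ r ∈ Finset.range R, η r * ∑ ω ∈ V, ‖G (w r ω)‖ ^ 2 ≤
      V.card * (2 * (F w0 - Fstar) + 2 * L * σ * ∑ r ∈ Finset.range R, η r ^ 2) := by
  have hstep : ∀ r ∈ Finset.range R, η r * ∑ ω ∈ V, ‖G (w r ω)‖ ^ 2 ≤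
      2 * (∑ ω ∈ V, F (w r ω) - ∑ ω ∈ V, F (w (r + 1) ω)) +
        2 * L * σ * V.card * η r ^ 2 := fun r hr => by
    have hr := Finset.mem_range.mp hr
    obtain ⟨hη0, hη1⟩ := hη r
    have hηL : L * η r ≤ 1 / 2 := by
      rw [le_div_iff₀ (by positivity)] at hη1
      linarith
    have hpt : ∀ ω ∈ V, η r * ‖G (w r ω)‖ ^ 2 ≤ 2 * (F (w r ω) - F (w (r + 1) ω)) +
        (4 * L * η r ^ 2 - 2 * η r) * inner ℝ (G (w r ω)) (d r ω) +
          2 * L * η r ^ 2 * ‖d r ω‖ ^ 2 := fun ω _ => by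
      have hdesc := le_add_inner_add_of_lipschitz_gradient hL.le hF hG (w r ω) (w (r + 1) ω)
      rw [hw r hr ω, sub_sub_cancel_left, inner_neg_right, norm_neg, real_inner_smul_right,
        inner_add_right, real_inner_self_eq_norm_sq, norm_smul, mul_pow, Real.norm_eq_abs,
        sq_abs, norm_add_sq_real, ← hw r hr ω] at hdesc
      have : L * η r * (η r * ‖G (w r ω)‖ ^ 2) ≤ 1 / 2 * (η r * ‖G (w r ω)‖ ^ 2) := by
        gcongr
      linarith
    have hsum := Finset.sum_le_sum hpt
    simp only [Finset.sum_add_distrib, ← Finset.mul_sum, Finset.sum_sub_distrib] at hsum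
    rw [hd r hr] at hsum
    have : 2 * L * η r ^ 2 * ∑ ω ∈ V, ‖d r ω‖ ^ 2 ≤ 2 * L * η r ^ 2 * (V.card * σ) := by
      gcongr
      exact hσ r hr
    linarith
  refine (Finset.sum_le_sum hstep).trans ?_
  rw [Finset.sum_add_distrib, ← Finset.mul_sum, Finset.sum_range_sub', ← Finset.mul_sum]
  have h0 : ∑ ω ∈ V, F (w 0 ω) = V.card * F w0 := by simp [hw0]
  have hend : V.card * Fstar ≤ ∑ ω ∈ V, F (w R ω) := by
    rw [← nsmul_eq_mul]
    exact Finset.card_nsmul_le_sum _ _ _ fun ω _ => hFstar _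
  rw [h0]
  linarith

end

theorem hasGradientAt_sum_mul {ι W : Type*} [Fintype ι] [NormedAddCommGroup W]
    [InnerProductSpace ℝ W] [CompleteSpace W] (c : ι → ℝ) {f : ι → W → ℝ} {g : ι → W} {u : W}
    (h : ∀ i, HasGradientAt (f i) (g i) u) :
    HasGradientAt (fun v => ∑ i, c i * f i v) (∑ i, c i • g i) u := by
  rw [hasGradientAt_iff_hasFDerivAt, map_sum]
  refine HasFDerivAt.fun_sum fun i _ => ?_
  rw [map_smul]
  exact (h i).hasFDerivAt.const_mul (c i)

theorem hasGradientAt_mean {ι W : Type*} [Fintype ι] [NormedAddCommGroup W]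
    [InnerProductSpace ℝ W] [CompleteSpace W] (n : ℝ) {f : ι → W → ℝ} {g : ι → W} {u : W}
    (h : ∀ i, HasGradientAt (f i) (g i) u) :
    HasGradientAt (fun v => (∑ i, f i v) / n) (n⁻¹ • ∑ i, g i) u := by
  simp only [div_eq_inv_mul, Finset.mul_sum, Finset.smul_sum]
  exact hasGradientAt_sum_mul (fun _ : ι => n⁻¹) h

section

variable {R J : ℕ} {K : Fin J → ℕ} {ns : Fin J → ℕ} {nc : (j : Fin J) → Fin (K j) → ℕ}

/-- Relabel, in round `r` only, the data points of every satellite and of every client. -/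
noncomputable def permuteRound (r : Fin R) (πS : ∀ j, Equiv.Perm (Fin (ns j)))
    (πC : ∀ j k, Equiv.Perm (Fin (nc j k))) :
    FLSampleSpace R J K ns nc ≃ FLSampleSpace R J K ns nc :=
  Equiv.piCongrRight fun r' => if r' = r then
    Equiv.prodCongr (Equiv.piCongrRight fun j => (πS j).finsetCongr)
      (Equiv.piCongrRight fun j => Equiv.piCongrRight fun k => (πC j k).finsetCongr)
    else Equiv.refl _

variable {r : Fin R} {πS : ∀ j, Equiv.Perm (Fin (ns j))}
  {πC : ∀ j k, Equiv.Perm (Fin (nc j k))}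

theorem permuteRound_apply_of_ne (ω : FLSampleSpace R J K ns nc) {r' : Fin R} (h : r' ≠ r) :
    permuteRound r πS πC ω r' = ω r' := by
  simp [permuteRound, h]

theorem permuteRound_apply_self_fst (ω : FLSampleSpace R J K ns nc) (j : Fin J) :
    (permuteRound r πS πC ω r).1 j = ((ω r).1 j).map (πS j).toEmbedding := by
  simp [permuteRound]

theorem permuteRound_apply_self_snd (ω : FLSampleSpace R J K ns nc) (j : Fin J)
    (k : Fin (K j)) :
    (permuteRound r πS πC ω r).2 j k = ((ω r).2 j k).map (πC j k).toEmbedding := by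
  simp [permuteRound]

/-- The uniform distribution on valid mini-batch choices is invariant under relabelling. -/
theorem sum_valid_permuteRound (lamC : ℕ → (j : Fin J) → Fin (K j) → ℕ)
    (lamS : ℕ → Fin J → ℕ) {Valid : Finset (FLSampleSpace R J K ns nc)}
    (hValid : ∀ ω, ω ∈ Valid ↔ ∀ r : Fin R, (∀ j, ((ω r).1 j).card = lamS r.1 j) ∧
      ∀ j k, ((ω r).2 j k).card = lamC r.1 j k)
    (Φ : FLSampleSpace R J K ns nc → ℝ) :
    ∑ ω ∈ Valid, Φ (permuteRound r πS πC ω) = ∑ ω ∈ Valid, Φ ω := by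
  refine Finset.sum_equiv (permuteRound r πS πC) (fun ω => ?_) fun _ _ => rfl
  rw [hValid, hValid]
  refine forall_congr' fun r' => ?_
  rcases eq_or_ne r' r with rfl | h
  · simp only [permuteRound_apply_self_fst, permuteRound_apply_self_snd, Finset.card_map]
  · rw [permuteRound_apply_of_ne ω h]

end

/-- Theorem 1 of the paper: convergence bound of the satellite-assisted federated
learning algorithm. -/
theorem satellite_fl_convergence_bound
    {X W : Type*} [NormedAddCommGroup X] [InnerProductSpace ℝ X]
    [NormedAddCommGroup W] [InnerProductSpace ℝ W] [CompleteSpace W]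
    -- clusters and clients
    (J : ℕ) (hJ : 0 < J) (K : Fin J → ℕ)
    -- dataset sizes
    (nc : (j : Fin J) → Fin (K j) → ℕ) (hnc : ∀ j k, 2 ≤ nc j k)
    (ns : Fin J → ℕ) (hns : ∀ j, 2 ≤ ns j)
    -- datasets
    (xc : (j : Fin J) → (k : Fin (K j)) → Fin (nc j k) → X)
    (xs : (j : Fin J) → Fin (ns j) → X)
    -- loss and its gradient in the model variable
    (ℓ : X → W → ℝ) (dℓ : X → W → W)
    (hgrad : ∀ (x : X) (u : W), HasGradientAt (ℓ x) (dℓ x u) u)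
    (L ρ Fstar : ℝ) (hL : 0 < L) (hρ : 0 ≤ ρ)
    -- client-side, satellite-side, cluster and global objectives
    (lC : (j : Fin J) → Fin (K j) → W → ℝ)
    (hlC : ∀ j k u, lC j k u = (∑ i, ℓ (xc j k i) u) / (nc j k : ℝ))
    (lS : (j : Fin J) → W → ℝ)
    (hlS : ∀ j u, lS j u = (∑ i, ℓ (xs j i) u) / (ns j : ℝ))
    (s : Fin J → ℝ) (hs : ∀ j, s j = (ns j : ℝ) + ∑ k, (nc j k : ℝ))
    (Fj : Fin J → W → ℝ)
    (hFj : ∀ j u, Fj j u = ((ns j : ℝ) * lS j u + ∑ k, (nc j k : ℝ) * lC j k u) / s j)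
    (F : W → ℝ) (hF : ∀ u, F u = (∑ j, Fj j u) / (J : ℝ))
    -- (i) L-Lipschitz gradients
    (hLipC : ∀ j k (u v : W),
      ‖gradient (lC j k) u - gradient (lC j k) v‖ ≤ L * ‖u - v‖)
    (hLipS : ∀ j (u v : W),
      ‖gradient (lS j) u - gradient (lS j) v‖ ≤ L * ‖u - v‖)
    -- (ii) squared data variability within each dataset
    (hvarC : ∀ j k (u : W) (i i' : Fin (nc j k)),
      ‖dℓ (xc j k i) u - dℓ (xc j k i') u‖ ^ 2 ≤ ρ * ‖xc j k i - xc j k i'‖ ^ 2)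
    (hvarS : ∀ j (u : W) (i i' : Fin (ns j)),
      ‖dℓ (xs j i) u - dℓ (xs j i') u‖ ^ 2 ≤ ρ * ‖xs j i - xs j i'‖ ^ 2)
    -- (iii) lower bound on the objective
    (hFstar : ∀ u : W, Fstar ≤ F u)
    -- rounds, step sizes and mini-batch sizes
    (R : ℕ) (hR : 0 < R)
    (η : ℕ → ℝ) (hη : ∀ r, 0 < η r ∧ η r ≤ 1 / (2 * L))
    (lamC : ℕ → (j : Fin J) → Fin (K j) → ℕ)
    (hlamC : ∀ r j k, 1 ≤ lamC r j k ∧ lamC r j k ≤ nc j k)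
    (lamS : ℕ → Fin J → ℕ)
    (hlamS : ∀ r j, 1 ≤ lamS r j ∧ lamS r j ≤ ns j)
    -- uniform randomness over mini-batch choices, independent across nodes and rounds:
    -- the uniform measure on the set of all valid tuples of subsets
    (Valid : Finset (FLSampleSpace R J K ns nc))
    (hValid : Valid = Finset.univ.filter (fun ω =>
      ∀ r : Fin R, (∀ j, ((ω r).1 j).card = lamS r.1 j) ∧
        (∀ j k, ((ω r).2 j k).card = lamC r.1 j k)))
    (E : (FLSampleSpace R J K ns nc → ℝ) → ℝ)
    (hE : ∀ f, E f = (∑ ω ∈ Valid, f ω) / (Valid.card : ℝ))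
    -- the iterates of the algorithm
    (w0 : W) (w : ℕ → FLSampleSpace R J K ns nc → W)
    (hw0 : ∀ ω, w 0 ω = w0)
    (hupdate : ∀ (r : Fin R) ω, w (r.1 + 1) ω = w r.1 ω -
      η r.1 • ((J : ℝ)⁻¹ • ∑ j, (s j)⁻¹ •
        ((ns j : ℝ) • ((lamS r.1 j : ℝ)⁻¹ • ∑ i ∈ (ω r).1 j, dℓ (xs j i) (w r.1 ω)) +
          ∑ k, (nc j k : ℝ) •
            ((lamC r.1 j k : ℝ)⁻¹ • ∑ i ∈ (ω r).2 j k, dℓ (xc j k i) (w r.1 ω)))))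
    -- sample variances of the datasets
    (VC : (j : Fin J) → Fin (K j) → ℝ)
    (hVC : ∀ j k, VC j k =
      (∑ i, ‖xc j k i - (nc j k : ℝ)⁻¹ • ∑ i', xc j k i'‖ ^ 2) / ((nc j k : ℝ) - 1))
    (VS : Fin J → ℝ)
    (hVS : ∀ j, VS j =
      (∑ i, ‖xs j i - (ns j : ℝ)⁻¹ • ∑ i', xs j i'‖ ^ 2) / ((ns j : ℝ) - 1))
    -- the quantities Γ_R and Ω
    (Γ Om : ℝ)
    (hΓ : Γ = ∑ r ∈ Finset.range R, η r)
    (hOm : Om = 2 * ∑ r ∈ Finset.range R, (J : ℝ)⁻¹ * ∑ j, (s j)⁻¹ *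
      ((∑ k, (1 - (lamC r j k : ℝ) / (nc j k : ℝ)) *
          (((nc j k : ℝ) - 1) * ρ / (lamC r j k : ℝ)) * VC j k) +
        (1 - (lamS r j : ℝ) / (ns j : ℝ)) *
          (((ns j : ℝ) - 1) * ρ / (lamS r j : ℝ)) * VS j)) :
    -- conclusion
    (1 / Γ) * ∑ r ∈ Finset.range R, η r * E (fun ω => ‖gradient F (w r ω)‖ ^ 2) ≤
      2 * (F w0 - Fstar) / Γ + (2 * L * Om / Γ) * ∑ r ∈ Finset.range R, (η r) ^ 2 := by
  have hJ' : (0 : ℝ) < J := by exact_mod_cast hJ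
  have hns' (j) : (2 : ℝ) ≤ ns j := by exact_mod_cast hns j
  have hnc' (j k) : (2 : ℝ) ≤ nc j k := by exact_mod_cast hnc j k
  have hspos (j) : 0 < s j := by
    have : 0 ≤ ∑ k, (nc j k : ℝ) := Finset.sum_nonneg fun k _ => Nat.cast_nonneg _
    rw [hs]
    linarith [hns' j]
  have hmem (ω) : ω ∈ Valid ↔ ∀ r : Fin R, (∀ j, ((ω r).1 j).card = lamS r.1 j) ∧
      ∀ j k, ((ω r).2 j k).card = lamC r.1 j k := by
    simp [hValid]
  have hadapted (r : ℕ) (hr : r ≤ R) (ω ω') (h : ∀ r' : Fin R, r'.1 < r → ω r' = ω' r') :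
      w r ω = w r ω' := by
    induction r with
    | zero => rw [hw0, hw0]
    | succ r ih =>
      have hω := hupdate ⟨r, hr⟩ ω
      have hω' := hupdate ⟨r, hr⟩ ω'
      rw [ih (by omega) fun r' hr' => h r' (by omega), h ⟨r, hr⟩ (Nat.lt_succ_self r)] at hω
      exact hω.trans hω'.symm
  have hwperm (r : Fin R) (πS πC ω) :
      w r.1 (permuteRound r πS πC ω) = w r.1 ω :=
    hadapted r r.2.le _ _ fun r' hr' =>
      permuteRound_apply_of_ne ω (by rintro rfl; exact lt_irrefl _ hr')
  have hexchS (r : Fin R) (j) (σ : Equiv.Perm (Fin (ns j))) (f : W → Finset (Fin (ns j)) → ℝ) :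
      ∑ ω ∈ Valid, f (w r.1 ω) (((ω r).1 j).map σ.toEmbedding) =
        ∑ ω ∈ Valid, f (w r.1 ω) ((ω r).1 j) := by
    rw [← sum_valid_permuteRound (r := r) (πS := Function.update (fun _ => Equiv.refl _) j σ)
      (πC := fun _ _ => Equiv.refl _) lamC lamS hmem fun ω => f (w r.1 ω) ((ω r).1 j)]
    simp only [hwperm, permuteRound_apply_self_fst, Function.update_self]
  have hexchC (r : Fin R) (j k) (σ : Equiv.Perm (Fin (nc j k)))
      (f : W → Finset (Fin (nc j k)) → ℝ) :
      ∑ ω ∈ Valid, f (w r.1 ω) (((ω r).2 j k).map σ.toEmbedding) =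
        ∑ ω ∈ Valid, f (w r.1 ω) ((ω r).2 j k) := by
    rw [← sum_valid_permuteRound (r := r) (πS := fun _ => Equiv.refl _)
      (πC := Function.update (fun _ _ => Equiv.refl _) j
        (Function.update (fun _ => Equiv.refl _) k σ)) lamC lamS hmem
        fun ω => f (w r.1 ω) ((ω r).2 j k)]
    simp only [hwperm, permuteRound_apply_self_snd, Function.update_self]
  -- gradients of the node objectives, and the deviations of the mini-batch gradients from them
  set gS : Fin J → W → W := fun j u => (ns j : ℝ)⁻¹ • ∑ i, dℓ (xs j i) u
  set gC : (j : Fin J) → Fin (K j) → W → W :=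
    fun j k u => (nc j k : ℝ)⁻¹ • ∑ i, dℓ (xc j k i) u
  have hlS' (j u) : HasGradientAt (lS j) (gS j u) u := by
    rw [funext (hlS j)]
    exact hasGradientAt_mean _ fun i => hgrad _ u
  have hlC' (j k u) : HasGradientAt (lC j k) (gC j k u) u := by
    rw [funext (hlC j k)]
    exact hasGradientAt_mean _ fun i => hgrad _ u
  set dS : Fin R → Fin J → FLSampleSpace R J K ns nc → W := fun r j ω =>
    (lamS r.1 j : ℝ)⁻¹ • ∑ i ∈ (ω r).1 j, dℓ (xs j i) (w r.1 ω) - gS j (w r.1 ω) with hdS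
  set dC : Fin R → (j : Fin J) → Fin (K j) → FLSampleSpace R J K ns nc → W := fun r j k ω =>
    (lamC r.1 j k : ℝ)⁻¹ • ∑ i ∈ (ω r).2 j k, dℓ (xc j k i) (w r.1 ω) - gC j k (w r.1 ω) with hdC
  have hdS_inner (r j) (v : W → W) : ∑ ω ∈ Valid, inner ℝ (v (w r.1 ω)) (dS r j ω) = 0 := by
    have : Nonempty (Fin (ns j)) := ⟨⟨0, by linarith [hns j]⟩⟩
    have := sum_inner_batch_mean_sub_mean (hexchS r j) (hlamS r.1 j).1
      (fun ω hω => ((hmem ω).mp hω r).1 j) (fun i => dℓ (xs j i)) v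
    rwa [Fintype.card_fin] at this
  have hdC_inner (r j k) (v : W → W) :
      ∑ ω ∈ Valid, inner ℝ (v (w r.1 ω)) (dC r j k ω) = 0 := by
    have : Nonempty (Fin (nc j k)) := ⟨⟨0, by linarith [hnc j k]⟩⟩
    have := sum_inner_batch_mean_sub_mean (hexchC r j k) (hlamC r.1 j k).1
      (fun ω hω => ((hmem ω).mp hω r).2 j k) (fun i => dℓ (xc j k i)) v
    rwa [Fintype.card_fin] at this
  have hdS_var (r : Fin R) (j) : ∑ ω ∈ Valid, ‖dS r j ω‖ ^ 2 ≤
      Valid.card * ((1 - (lamS r.1 j : ℝ) / ns j) * (ρ / lamS r.1 j) * VS j) := by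
    have := sum_norm_sq_batch_mean_sub_mean_le (by simpa using hns j) (hexchS r j)
      (hlamS r.1 j).1 (by simpa using (hlamS r.1 j).2)
      (fun ω hω => ((hmem ω).mp hω r).1 j) (g := fun i => dℓ (xs j i)) (hvarS j)
    rwa [Fintype.card_fin, ← hVS] at this
  have hdC_var (r : Fin R) (j k) : ∑ ω ∈ Valid, ‖dC r j k ω‖ ^ 2 ≤
      Valid.card * ((1 - (lamC r.1 j k : ℝ) / nc j k) * (ρ / lamC r.1 j k) * VC j k) := by
    have := sum_norm_sq_batch_mean_sub_mean_le (by simpa using hnc j k) (hexchC r j k)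
      (hlamC r.1 j k).1 (by simpa using (hlamC r.1 j k).2)
      (fun ω hω => ((hmem ω).mp hω r).2 j k) (g := fun i => dℓ (xc j k i)) (hvarC j k)
    rwa [Fintype.card_fin, ← hVC] at this
  -- all nodes, satellites and clients together, with their weights in the global objective
  set p : Fin J ⊕ (Σ j, Fin (K j)) → ℝ := Sum.elim (fun j => (J : ℝ)⁻¹ * ((s j)⁻¹ * ns j))
    (fun q => (J : ℝ)⁻¹ * ((s q.1)⁻¹ * nc q.1 q.2)) with hp
  have hp0 (ν) : 0 ≤ p ν := by
    rcases ν with j | ⟨j, k⟩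
    · have := (hspos j).le
      simp only [hp, Sum.elim_inl]
      positivity
    · have := (hspos j).le
      simp only [hp, Sum.elim_inr]
      positivity
  have hpsum (a : Fin J → ℝ) (b : (j : Fin J) → Fin (K j) → ℝ) :
      ∑ ν, p ν * Sum.elim a (fun q => b q.1 q.2) ν =
        (J : ℝ)⁻¹ * ∑ j, (s j)⁻¹ * (ns j * a j + ∑ k, nc j k * b j k) := by
    simp only [hp, Fintype.sum_sum_type, Fintype.sum_sigma, Sum.elim_inl, Sum.elim_inr]
    rw [← Finset.sum_add_distrib, Finset.mul_sum]
    simp only [mul_add, Finset.mul_sum, mul_assoc]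
  have hpsmul (a : Fin J → W) (b : (j : Fin J) → Fin (K j) → W) :
      ∑ ν, p ν • Sum.elim a (fun q => b q.1 q.2) ν =
        (J : ℝ)⁻¹ • ∑ j, (s j)⁻¹ • ((ns j : ℝ) • a j + ∑ k, (nc j k : ℝ) • b j k) := by
    simp only [hp, Fintype.sum_sum_type, Fintype.sum_sigma, Sum.elim_inl, Sum.elim_inr]
    rw [← Finset.sum_add_distrib, Finset.smul_sum]
    simp only [smul_add, Finset.smul_sum, smul_smul]
  have hp1 : ∑ ν, p ν = 1 := by
    have h := hpsum (fun _ => 1) fun _ _ => 1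
    simp only [mul_one, ← hs, inv_mul_cancel₀ (hspos _).ne', Finset.sum_const, Finset.card_univ,
      Fintype.card_fin, nsmul_eq_mul, inv_mul_cancel₀ hJ'.ne'] at h
    rw [← h]
    refine Finset.sum_congr rfl fun ν _ => ?_
    rcases ν with j | q <;> simp
  set g : Fin J ⊕ (Σ j, Fin (K j)) → W → W := fun ν u =>
    Sum.elim (fun j => gS j u) (fun q => gC q.1 q.2 u) ν with hg
  set G : W → W := fun u => ∑ ν, p ν • g ν u with hG
  have hFG (u) : HasGradientAt F (G u) u := by
    have hFeq : F = fun v => ∑ ν, p ν * Sum.elim lS (fun q => lC q.1 q.2) ν v := by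
      funext v
      have h := hpsum (fun j => lS j v) fun j k => lC j k v
      rw [hF, div_eq_inv_mul]
      simp only [hFj, div_eq_inv_mul]
      rw [← h]
      refine Finset.sum_congr rfl fun ν _ => ?_
      rcases ν with j | q <;> rfl
    rw [hFeq]
    refine hasGradientAt_sum_mul p fun ν => ?_
    rcases ν with j | q
    · exact hlS' j u
    · exact hlC' q.1 q.2 u
  have hGLip (u v) : ‖G u - G v‖ ≤ L * ‖u - v‖ := by
    have hnode (ν) : ‖g ν u - g ν v‖ ≤ L * ‖u - v‖ := by
      rcases ν with j | q
      · have := hLipS j u v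
        rwa [(hlS' j u).gradient, (hlS' j v).gradient] at this
      · have := hLipC q.1 q.2 u v
        rwa [(hlC' q.1 q.2 u).gradient, (hlC' q.1 q.2 v).gradient] at this
    calc ‖G u - G v‖ = ‖∑ ν, p ν • (g ν u - g ν v)‖ := by
          simp only [hG, smul_sub, Finset.sum_sub_distrib]
      _ ≤ ∑ ν, p ν * (L * ‖u - v‖) := by
          refine norm_sum_le_of_le _ fun ν _ => ?_
          rw [norm_smul, Real.norm_of_nonneg (hp0 ν)]
          exact mul_le_mul_of_nonneg_left (hnode ν) (hp0 ν)
      _ = L * ‖u - v‖ := by rw [← Finset.sum_mul, hp1, one_mul]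
  -- the total variance of a round is at most `Om`
  have hVS0 (j) : 0 ≤ VS j := by
    rw [hVS]
    exact div_nonneg (Finset.sum_nonneg fun i _ => sq_nonneg _) (by linarith [hns' j])
  have hVC0 (j k) : 0 ≤ VC j k := by
    rw [hVC]
    exact div_nonneg (Finset.sum_nonneg fun i _ => sq_nonneg _) (by linarith [hnc' j k])
  have hfac {n l : ℕ} (hln : l ≤ n) : 0 ≤ 1 - (l : ℝ) / n :=
    sub_nonneg.mpr (div_le_one_of_le₀ (by exact_mod_cast hln) (Nat.cast_nonneg n))
  have hnode_le {n l : ℕ} {v : ℝ} (hn : (2 : ℝ) ≤ n) (hln : l ≤ n) (hv : 0 ≤ v) :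
      n * ((1 - (l : ℝ) / n) * (ρ / l) * v) ≤
        2 * ((1 - (l : ℝ) / n) * (((n : ℝ) - 1) * ρ / l) * v) := by
    have h1 : 0 ≤ (1 - (l : ℝ) / n) * (ρ / l) * v :=
      mul_nonneg (mul_nonneg (hfac hln) (by positivity)) hv
    calc n * ((1 - (l : ℝ) / n) * (ρ / l) * v)
        ≤ (2 * ((n : ℝ) - 1)) * ((1 - (l : ℝ) / n) * (ρ / l) * v) := by
          gcongr
          linarith
      _ = _ := by ring
  have hterm0 {n l : ℕ} {v : ℝ} (hn : (2 : ℝ) ≤ n) (hln : l ≤ n) (hv : 0 ≤ v) :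
      0 ≤ (1 - (l : ℝ) / n) * (((n : ℝ) - 1) * ρ / l) * v :=
    mul_nonneg (mul_nonneg (hfac hln)
      (div_nonneg (mul_nonneg (by linarith) hρ) (Nat.cast_nonneg l))) hv
  set Q : ℕ → ℝ := fun r => (J : ℝ)⁻¹ * ∑ j, (s j)⁻¹ *
      ((∑ k, (1 - (lamC r j k : ℝ) / (nc j k : ℝ)) *
          (((nc j k : ℝ) - 1) * ρ / (lamC r j k : ℝ)) * VC j k) +
        (1 - (lamS r j : ℝ) / (ns j : ℝ)) *
          (((ns j : ℝ) - 1) * ρ / (lamS r j : ℝ)) * VS j) with hQ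
  have hQ0 (r) : 0 ≤ Q r :=
    mul_nonneg (by positivity) (Finset.sum_nonneg fun j _ =>
      mul_nonneg (inv_nonneg.mpr (hspos j).le) (add_nonneg
        (Finset.sum_nonneg fun k _ => hterm0 (hnc' j k) (hlamC r j k).2 (hVC0 j k))
        (hterm0 (hns' j) (hlamS r j).2 (hVS0 j))))
  have hOm0 : 0 ≤ Om := by
    rw [hOm]
    exact mul_nonneg zero_le_two (Finset.sum_nonneg fun r _ => hQ0 r)
  have hQOm (r : Fin R) : 2 * Q r ≤ Om := by
    rw [hOm]
    gcongr
    exact Finset.single_le_sum (f := Q) (fun r _ => hQ0 r) (Finset.mem_range.mpr r.2)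
  set d : Fin R → Fin J ⊕ (Σ j, Fin (K j)) → FLSampleSpace R J K ns nc → W := fun r ν ω =>
    Sum.elim (fun j => dS r j ω) (fun q => dC r q.1 q.2 ω) ν with hd
  have hround_var (r : Fin R) :
      ∑ ω ∈ Valid, ‖∑ ν, p ν • d r ν ω‖ ^ 2 ≤ Valid.card * Om := by
    set cS : Fin J → ℝ := fun j => (1 - (lamS r.1 j : ℝ) / ns j) * (ρ / lamS r.1 j) * VS j
    set cC : (j : Fin J) → Fin (K j) → ℝ :=
      fun j k => (1 - (lamC r.1 j k : ℝ) / nc j k) * (ρ / lamC r.1 j k) * VC j k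
    have hnode (ν) : ∑ ω ∈ Valid, ‖d r ν ω‖ ^ 2 ≤
        Valid.card * Sum.elim cS (fun q => cC q.1 q.2) ν := by
      rcases ν with j | q
      · exact hdS_var r j
      · exact hdC_var r q.1 q.2
    calc ∑ ω ∈ Valid, ‖∑ ν, p ν • d r ν ω‖ ^ 2
        ≤ ∑ ω ∈ Valid, ∑ ν, p ν * ‖d r ν ω‖ ^ 2 :=
          Finset.sum_le_sum fun ω _ => norm_sq_sum_smul_le hp0 hp1 _
      _ = ∑ ν, p ν * ∑ ω ∈ Valid, ‖d r ν ω‖ ^ 2 := by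
          rw [Finset.sum_comm]
          simp only [Finset.mul_sum]
      _ ≤ ∑ ν, p ν * (Valid.card * Sum.elim cS (fun q => cC q.1 q.2) ν) :=
          Finset.sum_le_sum fun ν _ => mul_le_mul_of_nonneg_left (hnode ν) (hp0 ν)
      _ = Valid.card * ((J : ℝ)⁻¹ * ∑ j, (s j)⁻¹ * (ns j * cS j + ∑ k, nc j k * cC j k)) := by
          rw [← hpsum, Finset.mul_sum]
          exact Finset.sum_congr rfl fun ν _ => mul_left_comm _ _ _
      _ ≤ Valid.card * (2 * Q r) := by
          rw [hQ, mul_left_comm 2, Finset.mul_sum Finset.univ _ (2 : ℝ)]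
          refine mul_le_mul_of_nonneg_left (mul_le_mul_of_nonneg_left
            (Finset.sum_le_sum fun j _ => ?_) (by positivity)) (Nat.cast_nonneg _)
          rw [mul_left_comm 2, add_comm, mul_add 2, Finset.mul_sum]
          refine mul_le_mul_of_nonneg_left (add_le_add (Finset.sum_le_sum fun k _ => ?_) ?_)
            (inv_nonneg.mpr (hspos j).le)
          · exact hnode_le (hnc' j k) (hlamC r j k).2 (hVC0 j k)
          · exact hnode_le (hns' j) (hlamS r j).2 (hVS0 j)
      _ ≤ Valid.card * Om := mul_le_mul_of_nonneg_left (hQOm r) (Nat.cast_nonneg _)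
  have hround_inner (r : Fin R) :
      ∑ ω ∈ Valid, inner ℝ (G (w r.1 ω)) (∑ ν, p ν • d r ν ω) = 0 := by
    simp only [inner_sum, real_inner_smul_right]
    rw [Finset.sum_comm]
    refine Finset.sum_eq_zero fun ν _ => ?_
    rw [← Finset.mul_sum]
    rcases ν with j | q
    · exact mul_eq_zero_of_right _ (hdS_inner r j G)
    · exact mul_eq_zero_of_right _ (hdC_inner r q.1 q.2 G)
  have hstep (r : Fin R) (ω) :
      w (r.1 + 1) ω = w r.1 ω - η r.1 • (G (w r.1 ω) + ∑ ν, p ν • d r ν ω) := by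
    rw [hupdate r ω, hG, hg, hd, hpsmul (fun j => dS r j ω) (fun j k => dC r j k ω)]
    have h := hpsmul (fun j => gS j (w r.1 ω)) (fun j k => gC j k (w r.1 ω))
    simp only [h, ← smul_add, ← Finset.sum_add_distrib]
    refine congrArg (fun z => w r.1 ω - η r.1 • ((J : ℝ)⁻¹ • z))
      (Finset.sum_congr rfl fun j _ => congrArg _ ?_)
    rw [add_add_add_comm, ← smul_add, ← Finset.sum_add_distrib]
    simp only [← smul_add, hdS, hdC, add_sub_cancel]
  have hmain := sgd_sum_norm_sq_gradient_le (V := Valid) hL hFG hGLip hFstar (R := R) hη hw0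
    (d := fun r ω => if hr : r < R then ∑ ν, p ν • d ⟨r, hr⟩ ν ω else 0)
    (σ := Om) (fun r hr ω => by simpa only [hr, dite_true] using hstep ⟨r, hr⟩ ω)
    (fun r hr => by simpa only [hr, dite_true] using hround_inner ⟨r, hr⟩)
    (fun r hr => by simpa only [hr, dite_true] using hround_var ⟨r, hr⟩)
  have hΓ0 : 0 < Γ := by
    rw [hΓ]
    exact Finset.sum_pos (fun r _ => (hη r).1) ⟨0, Finset.mem_range.mpr hR⟩
  have hbound : ∑ r ∈ Finset.range R, η r * E (fun ω => ‖gradient F (w r ω)‖ ^ 2) ≤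
      2 * (F w0 - Fstar) + 2 * L * Om * ∑ r ∈ Finset.range R, η r ^ 2 := by
    simp only [hE, (hFG _).gradient, ← mul_div_assoc]
    rw [← Finset.sum_div]
    refine div_le_of_le_mul₀ (Nat.cast_nonneg _) ?_ (hmain.trans_eq (mul_comm _ _))
    have := sub_nonneg.mpr (hFstar w0)
    positivity
  calc _ ≤ 1 / Γ * (2 * (F w0 - Fstar) + 2 * L * Om * ∑ r ∈ Finset.range R, η r ^ 2) := by
        gcongr
    _ = _ := by ring
end

section
/- Let X and H be real inner product spaces, n ≥ 2 a natural number, ρ ≥ 0, x : Fin n → X a family of data points, and g : Fin n → H a family of vectors satisfying the squared Lipschitz-in-data condition ‖g_i − g_j‖² ≤ ρ‖x_i − x_j‖² for all i, j. Let x̄ = (1/n) Σ_i x_i, ḡ = (1/n) Σ_i g_i, V = (1/(n−1)) Σ_i ‖x_i − x̄‖², and Z = (1/(n−1)) Σ_i ‖g_i − ḡ‖². Then Z ≤ 2((n−1)/n) ρ V. -/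
/-- The sum of squared pairwise distances of a finite family is twice its cardinality times
the sum of squared distances to the mean. -/
theorem sum_sum_norm_sub_sq_eq {ι E : Type*} [Fintype ι] [Nonempty ι]
    [NormedAddCommGroup E] [InnerProductSpace ℝ E] (v : ι → E) :
    ∑ i, ∑ j, ‖v i - v j‖ ^ 2 =
      2 * (Fintype.card ι : ℝ) * ∑ i, ‖v i - (Fintype.card ι : ℝ)⁻¹ • ∑ j, v j‖ ^ 2 := by
  set m := (Fintype.card ι : ℝ)⁻¹ • ∑ j, v j with hm
  have hcard : (Fintype.card ι : ℝ) ≠ 0 := Nat.cast_ne_zero.mpr Fintype.card_ne_zero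
  have hsum : ∑ j, (v j - m) = 0 := by
    rw [Finset.sum_sub_distrib, Finset.sum_const, Finset.card_univ, ← Nat.cast_smul_eq_nsmul ℝ,
      hm, smul_inv_smul₀ hcard, sub_self]
  have hpair : ∀ i j, ‖v i - v j‖ ^ 2 =
      ‖v i - m‖ ^ 2 - 2 * inner ℝ (v i - m) (v j - m) + ‖v j - m‖ ^ 2 := fun i j => by
    rw [← norm_sub_sq_real, sub_sub_sub_cancel_right]
  simp only [hpair, Finset.sum_add_distrib, Finset.sum_sub_distrib, ← Finset.mul_sum,
    ← inner_sum, hsum, inner_zero_right, Finset.sum_const, Finset.card_univ, nsmul_eq_mul]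
  ring

/-- A squared Lipschitz bound on pairwise distances passes to the sums of squared distances
to the means. -/
theorem sum_norm_sub_mean_sq_le {ι E F : Type*} [Fintype ι] [Nonempty ι]
    [NormedAddCommGroup E] [InnerProductSpace ℝ E]
    [NormedAddCommGroup F] [InnerProductSpace ℝ F]
    {c : ℝ} (u : ι → E) (v : ι → F) (h : ∀ i j, ‖v i - v j‖ ^ 2 ≤ c * ‖u i - u j‖ ^ 2) :
    ∑ i, ‖v i - (Fintype.card ι : ℝ)⁻¹ • ∑ j, v j‖ ^ 2 ≤
      c * ∑ i, ‖u i - (Fintype.card ι : ℝ)⁻¹ • ∑ j, u j‖ ^ 2 := by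
  have hcard : (0 : ℝ) < 2 * (Fintype.card ι : ℝ) :=
    mul_pos two_pos (Nat.cast_pos.mpr Fintype.card_pos)
  refine le_of_mul_le_mul_left ?_ hcard
  rw [← sum_sum_norm_sub_sq_eq, mul_left_comm, ← sum_sum_norm_sub_sq_eq]
  simp only [Finset.mul_sum]
  exact Finset.sum_le_sum fun i _ => Finset.sum_le_sum fun j _ => h i j

/-- Bound on the sample variance of the gradients in terms of the sample variance of the
data, under the squared data-variability condition (step (e) of the proof of Theorem 1). -/
theorem gradient_variance_bound {X H : Type*}
    [NormedAddCommGroup X] [InnerProductSpace ℝ X]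
    [NormedAddCommGroup H] [InnerProductSpace ℝ H]
    (n : ℕ) (hn : 2 ≤ n) (ρ : ℝ) (hρ : 0 ≤ ρ)
    (x : Fin n → X) (g : Fin n → H)
    (hlip : ∀ i j, ‖g i - g j‖ ^ 2 ≤ ρ * ‖x i - x j‖ ^ 2)
    (xbar : X) (hxbar : xbar = (n : ℝ)⁻¹ • ∑ i, x i)
    (gbar : H) (hgbar : gbar = (n : ℝ)⁻¹ • ∑ i, g i)
    (V : ℝ) (hV : V = (∑ i, ‖x i - xbar‖ ^ 2) / ((n : ℝ) - 1))
    (Z : ℝ) (hZ : Z = (∑ i, ‖g i - gbar‖ ^ 2) / ((n : ℝ) - 1)) :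
    Z ≤ 2 * (((n : ℝ) - 1) / (n : ℝ)) * ρ * V := by
  have : Nonempty (Fin n) := ⟨⟨0, by omega⟩⟩
  have hn' : (2 : ℝ) ≤ n := by exact_mod_cast hn
  have hle := sum_norm_sub_mean_sq_le x g hlip
  rw [Fintype.card_fin, ← hxbar, ← hgbar] at hle
  have hV0 : 0 ≤ V := hV ▸ div_nonneg (Finset.sum_nonneg fun i _ => sq_nonneg _) (by linarith)
  have hZV : Z ≤ ρ * V := by
    rw [hZ, hV, ← mul_div_assoc]
    exact div_le_div_of_nonneg_right hle (by linarith)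
  have hfactor : 1 ≤ 2 * (((n : ℝ) - 1) / n) := by
    rw [← mul_div_assoc, one_le_div (by linarith)]
    linarith
  rw [mul_assoc _ ρ V]
  exact hZV.trans (le_mul_of_one_le_left (mul_nonneg hρ hV0) hfactor)
end

section
/- Let X and H be real inner product spaces, n ≥ 2 and 1 ≤ λ ≤ n natural numbers, ρ ≥ 0, x : Fin n → X a family of data points, and g : Fin n → H a family of vectors satisfying ‖g_i − g_j‖² ≤ ρ‖x_i − x_j‖² for all i, j. Let x̄ = (1/n) Σ_i x_i, ḡ = (1/n) Σ_i g_i, and V = (1/(n−1)) Σ_i ‖x_i − x̄‖². Then the average over all λ-element subsets S of Fin n of ‖(1/λ) Σ_{i∈S} g_i − ḡ‖² is at most 2 (1 − λ/n) ((n−1)ρ/(λ n)) V; that is, (1/C(n,λ)) Σ_{S ⊆ Fin n, |S| = λ} ‖(1/λ) Σ_{i∈S} g_i − ḡ‖² ≤ 2 (1 − λ/n) ((n−1)ρ/(λ n)) V. -/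
open Finset in
theorem card_powersetCard_univ_filter_mem {n k : ℕ} (hk : 1 ≤ k) (i : Fin n) :
    (#{S ∈ powersetCard k (univ : Finset (Fin n)) | i ∈ S} : ℝ) * n = n.choose k * k := by
  have h := card_filter_powersetCard_subset {i} (univ : Finset (Fin n)) k (by simp) (by simpa)
  simp only [singleton_subset_iff, card_singleton, card_univ, Fintype.card_fin] at h
  rw [h]
  obtain ⟨m, rfl⟩ := Nat.exists_eq_add_of_le' (Nat.one_le_of_lt i.2)
  obtain ⟨k, rfl⟩ := Nat.exists_eq_add_of_le' hk
  have := Nat.add_one_mul_choose_eq m k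
  simp only [Nat.add_sub_cancel]
  rw [mul_comm]
  exact_mod_cast this

open Finset in
theorem card_powersetCard_univ_filter_mem_and_mem {n k : ℕ} (hk : 1 ≤ k) {i j : Fin n}
    (hij : i ≠ j) :
    (#{S ∈ powersetCard k (univ : Finset (Fin n)) | i ∈ S ∧ j ∈ S} : ℝ) * (n * (n - 1)) =
      n.choose k * (k * (k - 1)) := by
  obtain rfl | hk2 := hk.eq_or_lt
  · rw [card_eq_zero.2]
    · simp
    · rw [filter_eq_empty_iff]
      rintro S hS ⟨hi, hj⟩
      exact hij (card_le_one.1 (mem_powersetCard.1 hS).2.le i hi j hj)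
  have h := card_filter_powersetCard_subset {i, j} (univ : Finset (Fin n)) k (by simp)
    (by rw [card_pair hij]; exact hk2)
  simp only [insert_subset_iff, singleton_subset_iff, card_pair hij, card_univ,
    Fintype.card_fin] at h
  rw [h]
  obtain ⟨m, rfl⟩ : ∃ m, n = m + 2 := Nat.exists_eq_add_of_le' (by have := i.2; omega)
  obtain ⟨k, rfl⟩ : ∃ l, k = l + 2 := Nat.exists_eq_add_of_le' hk2
  have h1 := congrArg (Nat.cast (R := ℝ)) (Nat.add_one_mul_choose_eq m k)
  have h2 := congrArg (Nat.cast (R := ℝ)) (Nat.add_one_mul_choose_eq (m + 1) (k + 1))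
  simp only [Nat.add_sub_cancel]
  push_cast at *
  linear_combination (m + 2 : ℝ) * h1 + (k + 1 : ℝ) * h2

open Finset in
theorem sum_powersetCard_norm_sum_sq {H : Type*} [NormedAddCommGroup H] [InnerProductSpace ℝ H]
    {n k : ℕ} (hn : 2 ≤ n) (hk : 1 ≤ k) (f : Fin n → H) (hf : ∑ i, f i = 0) :
    ∑ S ∈ powersetCard k (univ : Finset (Fin n)), ‖∑ i ∈ S, f i‖ ^ 2 =
      n.choose k * (k * (n - k) / (n * (n - 1))) * ∑ i, ‖f i‖ ^ 2 := by
  have hn0 : (n : ℝ) ≠ 0 := by positivity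
  have hn1 : (n : ℝ) - 1 ≠ 0 := by
    have : (2 : ℝ) ≤ n := by exact_mod_cast hn
    linarith
  have expand (S : Finset (Fin n)) : ‖∑ i ∈ S, f i‖ ^ 2 =
      ∑ i, ∑ j, if i ∈ S ∧ j ∈ S then inner ℝ (f i) (f j) else 0 := by
    rw [← real_inner_self_eq_norm_sq]
    simp_rw [sum_inner, inner_sum]
    simp [ite_and]
  have count (i j : Fin n) : (#{S ∈ powersetCard k (univ : Finset (Fin n)) | i ∈ S ∧ j ∈ S} : ℝ) =
      n.choose k * (k * (k - 1) / (n * (n - 1))) +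
        if i = j then n.choose k * (k * (n - k) / (n * (n - 1)) : ℝ) else 0 := by
    split_ifs with hij
    · subst hij
      have := card_powersetCard_univ_filter_mem hk i
      simp only [and_self]
      field_simp
      linear_combination (n - 1 : ℝ) * this
    · have := card_powersetCard_univ_filter_mem_and_mem hk hij
      field_simp
      linear_combination this
  have zero : ∑ i, ∑ j, inner ℝ (f i) (f j) = 0 := by
    simp [← inner_sum, hf]
  calc
    _ = ∑ i, ∑ j, (#{S ∈ powersetCard k (univ : Finset (Fin n)) | i ∈ S ∧ j ∈ S} : ℝ) *
          inner ℝ (f i) (f j) := by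
      simp_rw [expand]
      rw [sum_comm]
      refine sum_congr rfl fun i _ => ?_
      rw [sum_comm]
      refine sum_congr rfl fun j _ => ?_
      rw [← sum_filter, sum_const, nsmul_eq_mul]
    _ = _ := by
      simp_rw [count, add_mul, sum_add_distrib, ← mul_sum, zero]
      simp [ite_mul, mul_sum]

open Finset in
theorem sum_sum_norm_sub_sq {H : Type*} [NormedAddCommGroup H] [InnerProductSpace ℝ H]
    {n : ℕ} (hn : n ≠ 0) (f : Fin n → H) :
    ∑ i, ∑ j, ‖f i - f j‖ ^ 2 =
      2 * n * ∑ i, ‖f i - (n : ℝ)⁻¹ • ∑ j, f j‖ ^ 2 := by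
  have hn0 : (n : ℝ) ≠ 0 := by exact_mod_cast hn
  set c := (n : ℝ)⁻¹ • ∑ j, f j with hc
  have zero : ∑ i, (f i - c) = 0 := by
    simp [hc, ← Nat.cast_smul_eq_nsmul ℝ, smul_smul, hn0]
  have expand (i j : Fin n) : ‖f i - f j‖ ^ 2 =
      ‖f i - c‖ ^ 2 - 2 * inner ℝ (f i - c) (f j - c) + ‖f j - c‖ ^ 2 := by
    rw [← norm_sub_sq_real, sub_sub_sub_cancel_right]
  simp_rw [expand, sum_add_distrib, sum_sub_distrib, ← mul_sum, ← inner_sum, zero]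
  simp [← mul_sum]
  ring

/-- Mini-batch gradient deviation bound: the expected squared deviation of the size-λ
without-replacement mini-batch average of the gradients from the full-gradient mean is
bounded by `2(1 − λ/n)((n−1)ρ/(λn))V`, where `V` is the sample variance of the data. -/
theorem minibatch_gradient_deviation_bound {X H : Type*}
    [NormedAddCommGroup X] [InnerProductSpace ℝ X]
    [NormedAddCommGroup H] [InnerProductSpace ℝ H]
    (n lam : ℕ) (hn : 2 ≤ n) (hlam : 1 ≤ lam) (hlamn : lam ≤ n)
    (ρ : ℝ) (hρ : 0 ≤ ρ)
    (x : Fin n → X) (g : Fin n → H)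
    (hlip : ∀ i j, ‖g i - g j‖ ^ 2 ≤ ρ * ‖x i - x j‖ ^ 2)
    (xbar : X) (hxbar : xbar = (n : ℝ)⁻¹ • ∑ i, x i)
    (gbar : H) (hgbar : gbar = (n : ℝ)⁻¹ • ∑ i, g i)
    (V : ℝ) (hV : V = (∑ i, ‖x i - xbar‖ ^ 2) / ((n : ℝ) - 1)) :
    (n.choose lam : ℝ)⁻¹ *
        ∑ S ∈ Finset.powersetCard lam (Finset.univ : Finset (Fin n)),
          ‖(lam : ℝ)⁻¹ • ∑ i ∈ S, g i - gbar‖ ^ 2 ≤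
      2 * (1 - (lam : ℝ) / (n : ℝ)) * (((n : ℝ) - 1) * ρ / ((lam : ℝ) * (n : ℝ))) * V := by
  have hn2 : (2 : ℝ) ≤ n := by exact_mod_cast hn
  have hl1 : (1 : ℝ) ≤ lam := by exact_mod_cast hlam
  have hln : (lam : ℝ) ≤ n := by exact_mod_cast hlamn
  have hn0 : (n : ℝ) ≠ 0 := by positivity
  have hl0 : (lam : ℝ) ≠ 0 := by positivity
  have hn1 : (n : ℝ) - 1 ≠ 0 := by linarith
  have hC : (n.choose lam : ℝ) ≠ 0 := by exact_mod_cast (Nat.choose_pos hlamn).ne'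
  have variance_le : ∑ i, ‖g i - gbar‖ ^ 2 ≤ ρ * ∑ i, ‖x i - xbar‖ ^ 2 := by
    have h : ∑ i, ∑ j, ‖g i - g j‖ ^ 2 ≤ ρ * ∑ i, ∑ j, ‖x i - x j‖ ^ 2 := by
      simp_rw [Finset.mul_sum]
      exact Finset.sum_le_sum fun i _ => Finset.sum_le_sum fun j _ => hlip i j
    rw [sum_sum_norm_sub_sq (by omega), sum_sum_norm_sub_sq (by omega), ← hgbar, ← hxbar] at h
    refine le_of_mul_le_mul_left ?_ (by positivity : (0 : ℝ) < 2 * n)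
    linarith
  have centered : ∑ i, (g i - gbar) = 0 := by
    simp [hgbar, ← Nat.cast_smul_eq_nsmul ℝ, smul_smul, hn0]
  have deviation (S) (hS : S ∈ Finset.powersetCard lam (Finset.univ : Finset (Fin n))) :
      ‖(lam : ℝ)⁻¹ • ∑ i ∈ S, g i - gbar‖ ^ 2 =
        ((lam : ℝ)⁻¹) ^ 2 * ‖∑ i ∈ S, (g i - gbar)‖ ^ 2 := by
    have : (lam : ℝ)⁻¹ • ∑ i ∈ S, g i - gbar = (lam : ℝ)⁻¹ • ∑ i ∈ S, (g i - gbar) := by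
      simp [(Finset.mem_powersetCard.1 hS).2, ← Nat.cast_smul_eq_nsmul ℝ, smul_smul, smul_sub, hl0]
    rw [this, norm_smul, mul_pow, Real.norm_eq_abs, sq_abs]
  rw [Finset.sum_congr rfl deviation, ← Finset.mul_sum,
    sum_powersetCard_norm_sum_sq hn hlam _ centered, hV]
  set A := ∑ i, ‖g i - gbar‖ ^ 2
  set B := ∑ i, ‖x i - xbar‖ ^ 2
  have hB : 0 ≤ B := by positivity
  have hn1' : (0 : ℝ) < n - 1 := by linarith
  have hnl : (0 : ℝ) ≤ n - lam := by linarith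
  calc
    _ = (n - lam) / (lam * n * (n - 1)) * A := by field_simp
    _ ≤ (n - lam) / (lam * n * (n - 1)) * (ρ * B) := by gcongr
    _ ≤ (2 * (n - 1) / n) * ((n - lam) / (lam * n * (n - 1)) * (ρ * B)) := by
      refine le_mul_of_one_le_left (by positivity) ?_
      rw [one_le_div (by positivity)]
      linarith
    _ = _ := by field_simp
end

section
/- Let K be a nonempty finite index set, B > 0, and for each k ∈ K let h_k : (0, ∞) → ℝ be strictly antitone (0 < u < v implies h_k(u) > h_k(v)). Suppose b* : K → ℝ satisfies b*_k > 0 for all k, Σ_{k∈K} b*_k = B, and h_k(b*_k) = ν for all k (a common value ν). Then for every b : K → ℝ with b_k > 0 for all k and Σ_{k∈K} b_k ≤ B, one has ν ≤ max_{k∈K} h_k(b_k). In other words, the equalizing allocation b* minimizes the maximum max_k h_k(b_k) over all feasible bandwidth allocations. -/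
/-- Min–max equalization principle for bandwidth allocation: if the equalizing allocation
`b*` uses the whole budget `B` and makes all strictly decreasing delays `h_k` equal to `ν`,
then any feasible allocation `b` has maximum delay at least `ν`. -/
theorem equalizing_allocation_minimizes_max {K : Type*} [Fintype K] [Nonempty K]
    (B : ℝ) (hB : 0 < B)
    (h : K → ℝ → ℝ)
    (hanti : ∀ k, ∀ u v : ℝ, 0 < u → u < v → h k v < h k u)
    (bstar : K → ℝ) (hbstarpos : ∀ k, 0 < bstar k)
    (hbstarsum : ∑ k, bstar k = B)
    (ν : ℝ) (hν : ∀ k, h k (bstar k) = ν)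
    (b : K → ℝ) (hbpos : ∀ k, 0 < b k) (hbsum : ∑ k, b k ≤ B) :
    ν ≤ Finset.univ.sup' Finset.univ_nonempty (fun k => h k (b k)) := by
  obtain ⟨k, -, hk⟩ : ∃ k ∈ Finset.univ, b k ≤ bstar k :=
    Finset.exists_le_of_sum_le Finset.univ_nonempty (hbsum.trans_eq hbstarsum.symm)
  refine Finset.le_sup'_of_le _ (Finset.mem_univ k) ?_
  rw [← hν k]
  rcases hk.eq_or_lt with heq | hlt
  · rw [heq]
  · exact (hanti k _ _ (hbpos k) hlt).le
end
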